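/- arXiv:1107.3156 — 5 statements merged into one kernel-verified Lean document; each statement's English description precedes it below -/
import Mathlib

section
/- Let (M, D, ∇) and (M', D', ∇') be vector spaces over K = k((u)) equipped with differentials and u-connections. If a chain map f : (M, D) → (M', D') is u-homotopic to 0, then f is a morphism of u-connections, i.e. ∇' ∘ f − f ∘ ∇ is u-homotopic to 0. Explicitly, if f = D' ∘ H + H ∘ D with H : M → M' K-linear, then ∇' ∘ f − f ∘ ∇ = D' ∘ G + G ∘ D, where G := ∇' ∘ H − H ∘ ∇ + (2u)⁻¹ • H (and G is K-linear). -/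
/-- The variable `u` of the field `K = k((u))` of formal Laurent series. -/
noncomputable def uVar (k : Type*) [Field k] : LaurentSeries k :=
  HahnSeries.single (1 : ℤ) (1 : k)

/-- If a chain map `f : (M, D) → (M', D')` between modules with
`u`-connections is `u`-homotopic to `0`, say `f = D' ∘ H + H ∘ D`, then `f` is a morphism
of `u`-connections, i.e. `nabla' ∘ f - f ∘ nabla` is `u`-homotopic to `0`; explicitly,
`nabla' ∘ f - f ∘ nabla = D' ∘ G + G ∘ D` where `G := nabla' ∘ H - H ∘ nabla + (2u)⁻¹ • H`,
and `G` is `K`-linear. -/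
theorem nullhomotopic_is_connection_morphism
    {k : Type*} [Field k] (h2 : (2 : k) ≠ 0)
    (δ : Derivation k (LaurentSeries k) (LaurentSeries k)) (hδ : δ (uVar k) = 1)
    {M M' : Type*} [AddCommGroup M] [Module (LaurentSeries k) M]
    [AddCommGroup M'] [Module (LaurentSeries k) M']
    (D : M →ₗ[LaurentSeries k] M) (hD : ∀ m, D (D m) = 0)
    (D' : M' →ₗ[LaurentSeries k] M') (hD' : ∀ m', D' (D' m') = 0)
    (nabla : M →+ M)
    (hL : ∀ (c : LaurentSeries k) (m : M), nabla (c • m) = δ c • m + c • nabla m)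
    (hC : ∀ m : M, nabla (D m) - D (nabla m) = (2 * uVar k)⁻¹ • D m)
    (nabla' : M' →+ M')
    (hL' : ∀ (c : LaurentSeries k) (m' : M'), nabla' (c • m') = δ c • m' + c • nabla' m')
    (hC' : ∀ m' : M', nabla' (D' m') - D' (nabla' m') = (2 * uVar k)⁻¹ • D' m')
    (f : M →ₗ[LaurentSeries k] M') (hf : ∀ m, f (D m) = D' (f m))
    (H : M →ₗ[LaurentSeries k] M') (hH : ∀ m, f m = D' (H m) + H (D m)) :
    (∃ G : M →ₗ[LaurentSeries k] M', ∀ m,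
      nabla' (f m) - f (nabla m) = D' (G m) + G (D m)) ∧
    (∀ (c : LaurentSeries k) (m : M),
      nabla' (H (c • m)) - H (nabla (c • m)) + (2 * uVar k)⁻¹ • H (c • m)
        = c • (nabla' (H m) - H (nabla m) + (2 * uVar k)⁻¹ • H m)) ∧
    (∀ m : M,
      nabla' (f m) - f (nabla m)
        = D' (nabla' (H m) - H (nabla m) + (2 * uVar k)⁻¹ • H m)
          + (nabla' (H (D m)) - H (nabla (D m)) + (2 * uVar k)⁻¹ • H (D m))) := by
  have linear : ∀ (c : LaurentSeries k) (m : M),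
      nabla' (H (c • m)) - H (nabla (c • m)) + (2 * uVar k)⁻¹ • H (c • m)
        = c • (nabla' (H m) - H (nabla m) + (2 * uVar k)⁻¹ • H m) := by
    intro c m
    rw [map_smul, hL, hL', map_add, map_smul, map_smul, smul_comm _ c (H m), smul_add, smul_sub]
    abel
  have homotopy : ∀ m : M,
      nabla' (f m) - f (nabla m)
        = D' (nabla' (H m) - H (nabla m) + (2 * uVar k)⁻¹ • H m)
          + (nabla' (H (D m)) - H (nabla (D m)) + (2 * uVar k)⁻¹ • H (D m)) := by
    intro m
    rw [hH, hH, eq_add_of_sub_eq (hC m), map_add, map_add, map_add, map_sub, map_smul, map_smul,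
      eq_add_of_sub_eq (hC' (H m))]
    abel
  exact ⟨⟨{ toFun := fun m => nabla' (H m) - H (nabla m) + (2 * uVar k)⁻¹ • H m
            map_add' := fun x y => by
              simp only [map_add, smul_add]
              abel
            map_smul' := linear }, homotopy⟩, linear, homotopy⟩
end

section
/- Let (M, D, ∇) and (M', D', ∇') be vector spaces over K = k((u)) equipped with differentials and u-connections, and let f, g : (M, D) → (M', D') be two chain maps that are u-homotopic to each other. If f is a morphism of u-connections from (M, D, ∇) to (M', D', ∇'), then so is g. -/
/-- The commutator of a `K`-linear map with two additive maps satisfying the Leibniz rule over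
the same `δ`, which is again `K`-linear. -/
def connectionCommutator {K : Type*} [CommRing K] (δ : K → K) {M M' : Type*}
    [AddCommGroup M] [Module K M] [AddCommGroup M'] [Module K M']
    (nabla : M →+ M) (hL : ∀ (c : K) (m : M), nabla (c • m) = δ c • m + c • nabla m)
    (nabla' : M' →+ M') (hL' : ∀ (c : K) (m : M'), nabla' (c • m) = δ c • m + c • nabla' m)
    (H : M →ₗ[K] M') : M →ₗ[K] M' where
  toFun m := nabla' (H m) - H (nabla m)
  map_add' x y := by simp only [map_add]; abel
  map_smul' c x := by
    simp only [map_smul, hL, hL', map_add, RingHom.id_apply, smul_sub]; abel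

theorem connectionCommutator_apply {K : Type*} [CommRing K] (δ : K → K) {M M' : Type*}
    [AddCommGroup M] [Module K M] [AddCommGroup M'] [Module K M']
    (nabla : M →+ M) (hL : ∀ (c : K) (m : M), nabla (c • m) = δ c • m + c • nabla m)
    (nabla' : M' →+ M') (hL' : ∀ (c : K) (m : M'), nabla' (c • m) = δ c • m + c • nabla' m)
    (H : M →ₗ[K] M') (m : M) :
    connectionCommutator δ nabla hL nabla' hL' H m = nabla' (H m) - H (nabla m) :=
  rfl

/-- If two `u`-homotopic chain maps `f, g : (M, D) → (M', D')` are given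
and `f` is a morphism of `u`-connections from `(M, D, nabla)` to `(M', D', nabla')`, then
so is `g`. -/
theorem connection_morphism_of_homotopic
    {k : Type*} [Field k] (h2 : (2 : k) ≠ 0)
    (δ : Derivation k (LaurentSeries k) (LaurentSeries k)) (hδ : δ (uVar k) = 1)
    {M M' : Type*} [AddCommGroup M] [Module (LaurentSeries k) M]
    [AddCommGroup M'] [Module (LaurentSeries k) M']
    (D : M →ₗ[LaurentSeries k] M) (hD : ∀ m, D (D m) = 0)
    (D' : M' →ₗ[LaurentSeries k] M') (hD' : ∀ m', D' (D' m') = 0)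
    (nabla : M →+ M)
    (hL : ∀ (c : LaurentSeries k) (m : M), nabla (c • m) = δ c • m + c • nabla m)
    (hC : ∀ m : M, nabla (D m) - D (nabla m) = (2 * uVar k)⁻¹ • D m)
    (nabla' : M' →+ M')
    (hL' : ∀ (c : LaurentSeries k) (m' : M'), nabla' (c • m') = δ c • m' + c • nabla' m')
    (hC' : ∀ m' : M', nabla' (D' m') - D' (nabla' m') = (2 * uVar k)⁻¹ • D' m')
    (f : M →ₗ[LaurentSeries k] M') (hf : ∀ m, f (D m) = D' (f m))
    (g : M →ₗ[LaurentSeries k] M') (hg : ∀ m, g (D m) = D' (g m))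
    (hfg : ∃ H : M →ₗ[LaurentSeries k] M', ∀ m, f m - g m = D' (H m) + H (D m))
    (hfmor : ∃ G : M →ₗ[LaurentSeries k] M', ∀ m,
      nabla' (f m) - f (nabla m) = D' (G m) + G (D m)) :
    ∃ G' : M →ₗ[LaurentSeries k] M', ∀ m,
      nabla' (g m) - g (nabla m) = D' (G' m) + G' (D m) := by
  obtain ⟨H, hH⟩ := hfg
  obtain ⟨G, hG⟩ := hfmor
  refine ⟨G - (connectionCommutator δ nabla hL nabla' hL' H + (2 * uVar k)⁻¹ • H), fun m => ?_⟩
  have hgm : ∀ x, g x = f x - (D' (H x) + H (D x)) := fun x => by rw [← hH x]; abel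
  have hfm : nabla' (f m) = D' (G m) + G (D m) + f (nabla m) := by rw [← hG m]; abel
  have hD'H : nabla' (D' (H m)) = (2 * uVar k)⁻¹ • D' (H m) + D' (nabla' (H m)) := by
    rw [← hC' (H m)]; abel
  have hHD : H (D (nabla m)) = H (nabla (D m)) - (2 * uVar k)⁻¹ • H (D m) := by
    rw [← map_smul, ← hC m, ← map_sub]; congr 1; abel
  simp only [hgm, map_sub, map_add, hfm, hD'H, hHD, LinearMap.sub_apply, LinearMap.add_apply,
    LinearMap.smul_apply, connectionCommutator_apply, map_smul]
  abel
end

section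
/- Let (M, D, ∇) and (M', D', ∇') be vector spaces over K = k((u)) equipped with differentials and u-connections. If f : (M, D) → (M', D') is a chain map which is both a u-quasi-isomorphism and a morphism of u-connections from (M, D, ∇) to (M', D', ∇'), then (M, D, ∇) and (M', D', ∇') are homotopy gauge equivalent; more precisely, there exists a chain map g : (M', D') → (M, D) such that (f, g) is a u-homotopy equivalence and g is a morphism of u-connections from (M', D', ∇') to (M, D, ∇). -/
/-- The cohomology `ker D ⧸ range D` of a module with an endomorphism `D`. -/
abbrev Cohomology {R M : Type*} [Ring R] [AddCommGroup M] [Module R M]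
    (D : M →ₗ[R] M) : Type _ :=
  ↥(LinearMap.ker D) ⧸ (LinearMap.range D).comap (LinearMap.ker D).subtype

/-- The map induced on cohomology by a chain map `f : (M, D) → (M', D')`. -/
noncomputable def cohomologyMap {R M M' : Type*} [Ring R] [AddCommGroup M] [Module R M]
    [AddCommGroup M'] [Module R M'] (D : M →ₗ[R] M) (D' : M' →ₗ[R] M')
    (f : M →ₗ[R] M') (hf : ∀ m, f (D m) = D' (f m)) :
    Cohomology D →ₗ[R] Cohomology D' :=
  Submodule.mapQ _ _
    (f.restrict (p := LinearMap.ker D) (q := LinearMap.ker D')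
      (fun x hx => by
        rw [LinearMap.mem_ker] at hx ⊢
        rw [← hf x, hx, map_zero]))
    (fun x hx => by
      rw [Submodule.mem_comap] at hx ⊢
      obtain ⟨y, hy⟩ := hx
      exact ⟨f y, by simp [LinearMap.restrict_apply, ← hf y, hy]⟩)

/-- Every linear map over a field has a generalized inverse. -/
theorem LinearMap.exists_generalizedInverse {K V W : Type*} [Field K] [AddCommGroup V] [Module K V]
    [AddCommGroup W] [Module K W] (D : V →ₗ[K] W) :
    ∃ T : W →ₗ[K] V, ∀ x, D (T (D x)) = D x := by
  obtain ⟨s, hs⟩ := D.rangeRestrict.exists_rightInverse_of_surjective D.range_rangeRestrict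
  obtain ⟨T, hT⟩ := s.exists_extend
  refine ⟨T, fun x => ?_⟩
  have h₁ : T (D x) = s (D.rangeRestrict x) := LinearMap.congr_fun hT (D.rangeRestrict x)
  have h₂ := congrArg Subtype.val (LinearMap.congr_fun hs (D.rangeRestrict x))
  rw [h₁]
  exact h₂

section ChainMaps

variable {K M M' : Type*} [Field K] [AddCommGroup M] [Module K M] [AddCommGroup M'] [Module K M']
  {D : M →ₗ[K] M} {D' : M' →ₗ[K] M'}

/-- Over a field, a chain map that sends cocycles to coboundaries is null-homotopic. -/
theorem exists_nullHomotopy_of_map_ker_le_range (hD : ∀ m, D (D m) = 0)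
    (φ : M →ₗ[K] M') (hφ : ∀ m, φ (D m) = D' (φ m))
    (h : ∀ m, D m = 0 → ∃ n, D' n = φ m) :
    ∃ H : M →ₗ[K] M', ∀ m, φ m = D' (H m) + H (D m) := by
  obtain ⟨T, hT⟩ := D.exists_generalizedInverse
  obtain ⟨T', hT'⟩ := D'.exists_generalizedInverse
  refine ⟨T' ∘ₗ φ ∘ₗ (LinearMap.id - T ∘ₗ D - D ∘ₗ T) + φ ∘ₗ T, fun m => ?_⟩
  obtain ⟨n, hn⟩ := h (m - T (D m) - D (T m)) (by simp [hT, hD])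
  have key : D' (T' (φ (m - T (D m) - D (T m)))) = φ (m - T (D m) - D (T m)) := by
    rw [← hn, hT']
  simp only [LinearMap.add_apply, LinearMap.comp_apply, LinearMap.sub_apply, LinearMap.id_apply,
    map_add, key, ← hφ, hT, hD]
  simp

theorem exists_eq_of_cohomologyMap_injective {f : M →ₗ[K] M'} (hf : ∀ m, f (D m) = D' (f m))
    (hinj : Function.Injective (cohomologyMap D D' f hf)) {m : M} (hm : D m = 0)
    (h : ∃ n, D' n = f m) : ∃ n, D n = m := by
  have h₀ : cohomologyMap D D' f hf (Submodule.Quotient.mk ⟨m, hm⟩) = 0 :=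
    (Submodule.Quotient.mk_eq_zero _).2 h
  exact (Submodule.Quotient.mk_eq_zero _).1 (hinj (h₀.trans (map_zero _).symm))

theorem exists_eq_sub_of_cohomologyMap_surjective {f : M →ₗ[K] M'}
    (hf : ∀ m, f (D m) = D' (f m))
    (hsurj : Function.Surjective (cohomologyMap D D' f hf)) {z : M'} (hz : D' z = 0) :
    ∃ m, D m = 0 ∧ ∃ n, D' n = f m - z := by
  obtain ⟨q, hq⟩ := hsurj (Submodule.Quotient.mk ⟨z, hz⟩)
  obtain ⟨⟨m, hm⟩, rfl⟩ := Submodule.Quotient.mk_surjective _ q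
  exact ⟨m, hm, (Submodule.Quotient.eq _).1 hq⟩

/-- Over a field, a chain map that is surjective on cohomology has a chain map which is a right
inverse to it on cohomology. -/
theorem exists_chainMap_rightInverse_of_cohomologyMap_surjective (hD' : ∀ m, D' (D' m) = 0)
    {f : M →ₗ[K] M'} (hf : ∀ m, f (D m) = D' (f m))
    (hsurj : Function.Surjective (cohomologyMap D D' f hf)) :
    ∃ g : M' →ₗ[K] M, (∀ m', g (D' m') = D (g m')) ∧
      ∀ z, D' z = 0 → ∃ n, D' n = f (g z) - z := by
  obtain ⟨T, hT⟩ := D'.exists_generalizedInverse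
  let p : (LinearMap.ker D × M') →ₗ[K] M' :=
    (f ∘ₗ (LinearMap.ker D).subtype).coprod D'
  obtain ⟨S, hS⟩ := p.exists_generalizedInverse
  let r : M' →ₗ[K] M' := LinearMap.id - T ∘ₗ D' - D' ∘ₗ T
  have hr : ∀ z, r z = z - T (D' z) - D' (T z) := fun _ => rfl
  have hrD : ∀ z, r (D' z) = 0 := fun z => by simp [hr, hT, hD']
  refine ⟨(LinearMap.ker D).subtype ∘ₗ LinearMap.fst K _ _ ∘ₗ S ∘ₗ r, fun z => ?_,
    fun z hz => ?_⟩
  · have h₀ : D ((S (r z)).1 : M) = 0 := (S (r z)).1.2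
    simp [hrD, h₀]
  · obtain ⟨m, hm, n, hn⟩ := exists_eq_sub_of_cohomologyMap_surjective hf hsurj
      (show D' (r z) = 0 by simp [hr, hT, hD'])
    have hp : p (⟨m, hm⟩, -n) = r z := by simp [p, hn]
    have hSp : f ((S (r z)).1 : M) + D' (S (r z)).2 = r z := by
      have := hS (⟨m, hm⟩, -n)
      rwa [hp] at this
    refine ⟨-(S (r z)).2 - T z, ?_⟩
    have hrz : r z = z - D' (T z) := by simp [hr, hz]
    simp only [LinearMap.comp_apply, Submodule.subtype_apply, LinearMap.fst_apply, map_sub,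
      map_neg]
    rw [eq_sub_of_add_eq hSp]
    nth_rewrite 2 [hrz]
    abel

end ChainMaps

/-- If `f : (M, D) → (M', D')` is a chain map which is both a
`u`-quasi-isomorphism and a morphism of `u`-connections from `(M, D, nabla)` to
`(M', D', nabla')`, then the two mixed complexes with `u`-connections are homotopy gauge
equivalent: there is a chain map `g` such that `(f, g)` is a `u`-homotopy equivalence and
`g` is a morphism of `u`-connections from `(M', D', nabla')` to `(M, D, nabla)`. -/
theorem connection_qis_homotopy_gauge_equivalence
    {k : Type*} [Field k] (h2 : (2 : k) ≠ 0)
    (δ : Derivation k (LaurentSeries k) (LaurentSeries k)) (hδ : δ (uVar k) = 1)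
    {M M' : Type*} [AddCommGroup M] [Module (LaurentSeries k) M]
    [AddCommGroup M'] [Module (LaurentSeries k) M']
    (D : M →ₗ[LaurentSeries k] M) (hD : ∀ m, D (D m) = 0)
    (D' : M' →ₗ[LaurentSeries k] M') (hD' : ∀ m', D' (D' m') = 0)
    (nabla : M →+ M)
    (hL : ∀ (c : LaurentSeries k) (m : M), nabla (c • m) = δ c • m + c • nabla m)
    (hC : ∀ m : M, nabla (D m) - D (nabla m) = (2 * uVar k)⁻¹ • D m)
    (nabla' : M' →+ M')
    (hL' : ∀ (c : LaurentSeries k) (m' : M'), nabla' (c • m') = δ c • m' + c • nabla' m')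
    (hC' : ∀ m' : M', nabla' (D' m') - D' (nabla' m') = (2 * uVar k)⁻¹ • D' m')
    (f : M →ₗ[LaurentSeries k] M') (hf : ∀ m, f (D m) = D' (f m))
    (hqis : Function.Bijective (cohomologyMap D D' f hf))
    (hfmor : ∃ G : M →ₗ[LaurentSeries k] M', ∀ m,
      nabla' (f m) - f (nabla m) = D' (G m) + G (D m)) :
    ∃ g : M' →ₗ[LaurentSeries k] M,
      (∀ m', g (D' m') = D (g m')) ∧
      (∃ H : M →ₗ[LaurentSeries k] M, ∀ m, g (f m) - m = D (H m) + H (D m)) ∧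
      (∃ H' : M' →ₗ[LaurentSeries k] M', ∀ m', f (g m') - m' = D' (H' m') + H' (D' m')) ∧
      (∃ G' : M' →ₗ[LaurentSeries k] M, ∀ m',
        nabla (g m') - g (nabla' m') = D (G' m') + G' (D' m')) := by
  obtain ⟨g, hg, hfg⟩ := exists_chainMap_rightInverse_of_cohomologyMap_surjective hD' hf hqis.2
  obtain ⟨G, hG⟩ := hfmor
  refine ⟨g, hg, ?_, ?_, ?_⟩
  · refine exists_nullHomotopy_of_map_ker_le_range (D' := D) hD (g ∘ₗ f - LinearMap.id)
      (fun m => by simp [hf, hg]) fun m hm => ?_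
    refine exists_eq_of_cohomologyMap_injective hf hqis.1 (by simp [← hg, ← hf, hm]) ?_
    simpa using hfg (f m) (by rw [← hf, hm, map_zero])
  · exact exists_nullHomotopy_of_map_ker_le_range hD' (f ∘ₗ g - LinearMap.id)
      (fun m => by simp [hf, hg]) hfg
  · let E : M' →ₗ[LaurentSeries k] M :=
      { toFun := fun m' => nabla (g m') - g (nabla' m')
        map_add' := fun x y => by
          simp only [map_add]
          abel
        map_smul' := fun c x => by
          simp only [map_smul, hL, hL', map_add, RingHom.id_apply, smul_sub]
          abel }
    have hE : ∀ m', E m' = nabla (g m') - g (nabla' m') := fun _ => rfl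
    have hC₁ : ∀ m, nabla (D m) = D (nabla m) + (2 * uVar k)⁻¹ • D m :=
      fun m => sub_eq_iff_eq_add'.1 (hC m)
    have hC₁' : ∀ m', nabla' (D' m') = D' (nabla' m') + (2 * uVar k)⁻¹ • D' m' :=
      fun m' => sub_eq_iff_eq_add'.1 (hC' m')
    have hED : ∀ m', E (D' m') = D (E m') := fun m' => by
      simp only [hE, hg, hC₁, hC₁', map_add, map_sub, map_smul]
      abel
    refine exists_nullHomotopy_of_map_ker_le_range hD' E hED fun z hz => ?_
    refine exists_eq_of_cohomologyMap_injective hf hqis.1 (by rw [← hED, hz, map_zero]) ?_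
    have hnz : D' (nabla' z) = 0 := by
      have h := hC' z
      rwa [hz, map_zero, smul_zero, zero_sub, neg_eq_zero] at h
    obtain ⟨a, ha⟩ := hfg z hz
    obtain ⟨b, hb⟩ := hfg (nabla' z) hnz
    have hfn : f (nabla (g z)) = nabla' (f (g z)) - D' (G (g z)) := by
      have h := hG (g z)
      rw [← hg, hz, map_zero, map_zero, add_zero] at h
      rw [← h]
      abel
    refine ⟨nabla' a + (2 * uVar k)⁻¹ • a - G (g z) - b, ?_⟩
    have hna : nabla' (f (g z)) - nabla' z = D' (nabla' a) + (2 * uVar k)⁻¹ • D' a := by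
      rw [← map_sub, ← ha, hC₁']
    rw [hE, map_sub f, hfn, map_sub, map_sub, map_add, map_smul, ← hna, hb]
    abel
end

section
/- Transfer of u-connections along a u-homotopy equivalence: let M, M' be vector spaces over K = k((u)), let b, B : M → M be K-linear maps with b ∘ b = 0, B ∘ B = 0 and b ∘ B + B ∘ b = 0, and set D := b + u • B (so D is a differential on M). Let D' be a differential on M', let (ι, p) be a u-homotopy equivalence between (M, D) and (M', D') with chosen K-linear homotopies H : M → M and H' : M' → M' satisfying p ∘ ι = id_M + D ∘ H + H ∘ D and ι ∘ p = id_{M'} + D' ∘ H' + H' ∘ D'. Let ∇' be a u-connection on (M', D'), and let 𝒅 : M → M be an additive map satisfying 𝒅(c • m) = δ(c) • m + c • 𝒅m for all c ∈ K, m ∈ M, and commuting with b and B (𝒅 ∘ b = b ∘ 𝒅 and 𝒅 ∘ B = B ∘ 𝒅; such a 𝒅 models d/du). Then the map ∇ := p ∘ ∇' ∘ ι − (D ∘ H + H ∘ D) ∘ 𝒅 + (2u)⁻¹ • (H ∘ (b − u • B)) is a u-connection on (M, D), and both ι and p are morphisms of u-connections between (M, D, ∇) and (M', D', ∇'); in particular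 (M, D, ∇) and (M', D', ∇') are homotopy gauge equivalent with respect to ι and p. -/
/-- The difference of two additive maps satisfying Leibniz rules over the same `δ` is linear. -/
theorem exists_linearMap_eq_sub_of_leibniz {R M M' : Type*} [Ring R]
    [AddCommGroup M] [Module R M] [AddCommGroup M'] [Module R M']
    (δ : R → R) (φ : M → M') (f g : M →+ M')
    (hf : ∀ (c : R) (m : M), f (c • m) = δ c • φ m + c • f m)
    (hg : ∀ (c : R) (m : M), g (c • m) = δ c • φ m + c • g m) :
    ∃ X : M →ₗ[R] M', ∀ m, X m = f m - g m :=
  ⟨{ toFun := fun m => f m - g m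
     map_add' := fun x y => by rw [map_add, map_add]; abel
     map_smul' := fun c x => by
      rw [hf, hg, RingHom.id_apply, smul_sub]; abel }, fun _ => rfl⟩

/-- Transfer of connections over a commutative ring `R` in which `2 * u` has inverse `w`. -/
theorem transfer_of_uConnection_of_commRing {R : Type*} [CommRing R]
    (δ : R → R) (u : R) (hδ : δ u = 1) (w : R) (hw : w * (2 * u) = 1)
    {M M' : Type*} [AddCommGroup M] [Module R M]
    [AddCommGroup M'] [Module R M']
    (b B : M →ₗ[R] M)
    (hb : ∀ m, b (b m) = 0) (hB : ∀ m, B (B m) = 0)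
    (hbB : ∀ m, b (B m) + B (b m) = 0)
    (D : M →ₗ[R] M) (hDdef : D = b + u • B)
    (D' : M' →ₗ[R] M')
    (iota : M →ₗ[R] M') (hiota : ∀ m, iota (D m) = D' (iota m))
    (p : M' →ₗ[R] M) (hp : ∀ m', p (D' m') = D (p m'))
    (H : M →ₗ[R] M)
    (hH : ∀ m, p (iota m) = m + (D (H m) + H (D m)))
    (H' : M' →ₗ[R] M')
    (hH' : ∀ m', iota (p m') = m' + (D' (H' m') + H' (D' m')))
    (nabla' : M' →+ M')
    (hL' : ∀ (c : R) (m' : M'), nabla' (c • m') = δ c • m' + c • nabla' m')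
    (hC' : ∀ m' : M', nabla' (D' m') - D' (nabla' m') = w • D' m')
    (d : M →+ M)
    (hdL : ∀ (c : R) (m : M), d (c • m) = δ c • m + c • d m)
    (hdb : ∀ m, d (b m) = b (d m)) (hdB : ∀ m, d (B m) = B (d m))
    (N : M → M)
    (hN : ∀ m, N m = p (nabla' (iota m)) - (D (H (d m)) + H (D (d m)))
        + w • H (b m - u • B m)) :
    (∀ m, D (D m) = 0) ∧
    (∀ (c : R) (m : M), N (c • m) = δ c • m + c • N m) ∧
    (∀ m : M, N (D m) - D (N m) = w • D m) ∧
    (∃ G : M →ₗ[R] M', ∀ m,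
      nabla' (iota m) - iota (N m) = D' (G m) + G (D m)) ∧
    (∃ G' : M' →ₗ[R] M, ∀ m',
      N (p m') - p (nabla' m') = D (G' m') + G' (D' m')) := by
  have hD (m : M) : D m = b m + u • B m := by simp [hDdef]
  have hDD (m : M) : D (D m) = 0 := by
    simp only [hD, map_add, map_smul, hb, hB]
    linear_combination (norm := module) u • hbB m
  have hdD (m : M) : d (D m) = D (d m) + B m := by
    simp only [hD, map_add, hdL, hdb, hdB, hδ]
    module
  obtain ⟨S, hS⟩ : ∃ S : M →ₗ[R] M, ∀ m, S m = w • (b m - u • B m) :=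
    ⟨w • (b - u • B), fun _ => rfl⟩
  have hBS (m : M) : B m = w • D m - S m := by
    rw [hS, hD]
    linear_combination (norm := module) -(congrArg (fun c => c • B m) hw)
  have hDS (m : M) : D (S m) = -S (D m) := by
    simp only [hS, hD, map_add, map_sub, map_smul, hb, hB]
    module
  replace hN (m : M) : N m = p (nabla' (iota m)) - (D (H (d m)) + H (D (d m))) + H (S m) := by
    rw [hN, hS, map_smul]
  clear hS hD hDdef hw hb hB hbB hdb hdB
  obtain ⟨X, hX⟩ := exists_linearMap_eq_sub_of_leibniz δ iota
    (nabla'.comp iota.toAddMonoidHom) (iota.toAddMonoidHom.comp d)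
    (by simp [hL']) (by simp [hdL])
  obtain ⟨Q, hQ⟩ := exists_linearMap_eq_sub_of_leibniz δ p
    (p.toAddMonoidHom.comp nabla') (d.comp p.toAddMonoidHom)
    (by simp [hL']) (by simp [hdL])
  obtain ⟨h, hh⟩ := exists_linearMap_eq_sub_of_leibniz δ H
    (d.comp H.toAddMonoidHom) (H.toAddMonoidHom.comp d)
    (by simp [hdL]) (by simp [hdL])
  simp only [AddMonoidHom.comp_apply, LinearMap.toAddMonoidHom_coe] at hX hQ hh
  have hXD (m : M) : D' (X m) = X (D m) - iota (S m) := by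
    simp only [hX, hdD, hBS, map_add, map_sub, map_smul, hiota]
    linear_combination (norm := module) -(hC' (iota m))
  have hQD (m' : M') : Q (D' m') = D (Q m') + S (p m') := by
    have e := congrArg p (hC' m')
    simp only [map_sub, map_smul, hp] at e
    simp only [hQ, hdD, hBS, map_sub, hp]
    linear_combination (norm := module) e
  obtain ⟨Z, hZ⟩ : ∃ Z : M →ₗ[R] M, ∀ m, Z m = p (X m) + H (S m) :=
    ⟨p ∘ₗ X + H ∘ₗ S, fun _ => rfl⟩
  have hSZ (m : M) : S m = Z (D m) - D (Z m) := by
    have e := congrArg p (hXD m)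
    have e' := hH (S m)
    simp only [map_sub, hp, hDS, map_neg] at e e'
    simp only [hZ, map_add]
    linear_combination (norm := module) e - e'
  refine ⟨hDD, fun c m => ?_, fun m => ?_, ⟨(H' ∘ₗ iota - iota ∘ₗ H) ∘ₗ Z - H' ∘ₗ X, fun m => ?_⟩,
    ⟨Q ∘ₗ H' + h ∘ₗ p + w • (H ∘ₗ p) - Z ∘ₗ (p ∘ₗ H' - H ∘ₗ p), fun m' => ?_⟩⟩
  · simp only [hN, map_smul, map_add, hL', hdL]
    linear_combination (norm := module) δ c • hH m
  · have e := congrArg p (hC' (iota m))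
    have e' := congrArg D (hH m)
    simp only [map_sub, map_smul, map_add, hp, hDD] at e e'
    simp only [hN, hdD, hBS, hDD, hDS, hiota, map_add, map_sub, map_smul, map_neg, map_zero]
    linear_combination (norm := module) e + w • e'
  · have hX' (m : M) : nabla' (iota m) = X m + iota (d m) := by rw [hX]; abel
    have e₁ := hH' (X m)
    have e₂ := congrArg iota (hH (d m))
    have e₃ := congrArg (fun x => H' (iota x) - iota (H x)) (hSZ m)
    have e₄ := hH' (iota (Z m))
    have e₅ := congrArg iota (hH (Z m))
    simp only [hXD, hiota, map_add, map_sub] at e₁ e₂ e₃ e₄ e₅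
    simp only [hN, hX', LinearMap.sub_apply, LinearMap.comp_apply, hiota, map_add, map_sub]
    linear_combination (norm := module) -e₁ - e₂ + e₃ + e₄ - e₅
  · have hQ' (m' : M') : p (nabla' m') = Q m' + d (p m') := by rw [hQ]; abel
    have hh' (m : M) : d (H m) = h m + H (d m) := by rw [hh]; abel
    have e₁ := congrArg Q (hH' m')
    have e₂ := congrArg d (hH (p m'))
    have e₃ := hSZ (p (H' m'))
    have e₄ := hSZ (H (p m'))
    have e₅ := congrArg (fun x => Z (p x)) (hH' m')
    have e₆ := congrArg Z (hH (p m'))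
    simp only [hQD, hdD, hBS, hh', hp, map_add, map_sub, map_smul] at e₁ e₂ e₃ e₄ e₅ e₆
    simp only [hN, hQ', LinearMap.sub_apply, LinearMap.add_apply, LinearMap.smul_apply,
      LinearMap.comp_apply, hp, map_add, map_sub, map_smul]
    linear_combination (norm := module) e₁ + e₂ + e₃ - e₄ - e₅ + e₆
/-- Transfer of `u`-connections along a `u`-homotopy equivalence: given a
mixed complex `(M, b, B)` with `u`-totalization differential `D = b + u • B`, a complex
`(M', D')` with a `u`-connection `nabla'`, a `u`-homotopy equivalence `(iota, p)` with
chosen homotopies `H`, `H'`, and an operator `d` modelling `d/du` (a `δ`-derivation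
commuting with `b` and `B`), the formula
`N := p ∘ nabla' ∘ iota - (D ∘ H + H ∘ D) ∘ d + (2u)⁻¹ • (H ∘ (b - u • B))`
defines a `u`-connection on `(M, D)`, and both `iota` and `p` are morphisms of
`u`-connections; in particular `(M, D, N)` and `(M', D', nabla')` are homotopy gauge
equivalent with respect to `iota` and `p`. -/
theorem transfer_of_uConnection
    {k : Type*} [Field k] (h2 : (2 : k) ≠ 0)
    (δ : Derivation k (LaurentSeries k) (LaurentSeries k)) (hδ : δ (uVar k) = 1)
    {M M' : Type*} [AddCommGroup M] [Module (LaurentSeries k) M]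
    [AddCommGroup M'] [Module (LaurentSeries k) M']
    (b B : M →ₗ[LaurentSeries k] M)
    (hb : ∀ m, b (b m) = 0) (hB : ∀ m, B (B m) = 0)
    (hbB : ∀ m, b (B m) + B (b m) = 0)
    (D : M →ₗ[LaurentSeries k] M) (hDdef : D = b + uVar k • B)
    (D' : M' →ₗ[LaurentSeries k] M') (hD' : ∀ m', D' (D' m') = 0)
    (iota : M →ₗ[LaurentSeries k] M') (hiota : ∀ m, iota (D m) = D' (iota m))
    (p : M' →ₗ[LaurentSeries k] M) (hp : ∀ m', p (D' m') = D (p m'))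
    (H : M →ₗ[LaurentSeries k] M)
    (hH : ∀ m, p (iota m) = m + (D (H m) + H (D m)))
    (H' : M' →ₗ[LaurentSeries k] M')
    (hH' : ∀ m', iota (p m') = m' + (D' (H' m') + H' (D' m')))
    (nabla' : M' →+ M')
    (hL' : ∀ (c : LaurentSeries k) (m' : M'), nabla' (c • m') = δ c • m' + c • nabla' m')
    (hC' : ∀ m' : M', nabla' (D' m') - D' (nabla' m') = (2 * uVar k)⁻¹ • D' m')
    (d : M →+ M)
    (hdL : ∀ (c : LaurentSeries k) (m : M), d (c • m) = δ c • m + c • d m)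
    (hdb : ∀ m, d (b m) = b (d m)) (hdB : ∀ m, d (B m) = B (d m))
    (N : M → M)
    (hN : ∀ m, N m = p (nabla' (iota m)) - (D (H (d m)) + H (D (d m)))
        + (2 * uVar k)⁻¹ • H (b m - uVar k • B m)) :
    (∀ m, D (D m) = 0) ∧
    (∀ (c : LaurentSeries k) (m : M), N (c • m) = δ c • m + c • N m) ∧
    (∀ m : M, N (D m) - D (N m) = (2 * uVar k)⁻¹ • D m) ∧
    (∃ G : M →ₗ[LaurentSeries k] M', ∀ m,
      nabla' (iota m) - iota (N m) = D' (G m) + G (D m)) ∧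
    (∃ G' : M' →ₗ[LaurentSeries k] M, ∀ m',
      N (p m') - p (nabla' m') = D (G' m') + G' (D' m')) := by
  have hu : uVar k ≠ 0 := by simp [uVar]
  have h2u : (2 * uVar k) ≠ 0 := by
    refine mul_ne_zero ?_ hu
    have h := (map_ne_zero (algebraMap k (LaurentSeries k))).mpr h2
    rwa [map_ofNat] at h
  exact transfer_of_uConnection_of_commRing δ (uVar k) hδ _ (inv_mul_cancel₀ h2u)
    b B hb hB hbB D hDdef D' iota hiota p hp H hH H' hH' nabla' hL' hC' d hdL hdb hdB N hN
end

section
/- The dual of a u-connection is a u-connection: let e : K → K be a k-algebra automorphism of K = k((u)) with e(u) = −u and δ ∘ e = −(e ∘ δ) (modelling the substitution u ↦ −u). Let M, M' be K-vector spaces with differentials D, D', and let σ : M → M' be an additive bijection that is e-semilinear, i.e. σ(c • m) = e(c) • σ(m) for all c ∈ K and m ∈ M, and that intertwines the differentials, σ ∘ D = D' ∘ σ. If ∇' is a u-connection on (M', D'), then the map ∇ := −(σ⁻¹ ∘ ∇' ∘ σ) is a u-connection on (M, D). -/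
/-- The dual of a `u`-connection is a `u`-connection: if `e` is the
`k`-algebra automorphism of `K = k((u))` modelling `u ↦ -u` (so `e u = -u` and
`δ ∘ e = -(e ∘ δ)`), `sigma : M → M'` is an additive, `e`-semilinear bijection
intertwining the differentials, and `nabla'` is a `u`-connection on `(M', D')`, then
`nabla := -(sigma⁻¹ ∘ nabla' ∘ sigma)` is a `u`-connection on `(M, D)`. -/
theorem dual_uConnection
    {k : Type*} [Field k] (h2 : (2 : k) ≠ 0)
    (δ : Derivation k (LaurentSeries k) (LaurentSeries k)) (hδ : δ (uVar k) = 1)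
    (e : LaurentSeries k ≃ₐ[k] LaurentSeries k) (he : e (uVar k) = -uVar k)
    (hδe : ∀ c : LaurentSeries k, δ (e c) = -(e (δ c)))
    {M M' : Type*} [AddCommGroup M] [Module (LaurentSeries k) M]
    [AddCommGroup M'] [Module (LaurentSeries k) M']
    (D : M →ₗ[LaurentSeries k] M) (hD : ∀ m, D (D m) = 0)
    (D' : M' →ₗ[LaurentSeries k] M') (hD' : ∀ m', D' (D' m') = 0)
    (sigma : M ≃+ M')
    (hsemi : ∀ (c : LaurentSeries k) (m : M), sigma (c • m) = e c • sigma m)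
    (hsigmaD : ∀ m, sigma (D m) = D' (sigma m))
    (nabla' : M' →+ M')
    (hL' : ∀ (c : LaurentSeries k) (m' : M'), nabla' (c • m') = δ c • m' + c • nabla' m')
    (hC' : ∀ m' : M', nabla' (D' m') - D' (nabla' m') = (2 * uVar k)⁻¹ • D' m') :
    (∀ (c : LaurentSeries k) (m : M),
      -sigma.symm (nabla' (sigma (c • m)))
        = δ c • m + c • (-sigma.symm (nabla' (sigma m)))) ∧
    (∀ m : M,
      -sigma.symm (nabla' (sigma (D m))) - D (-sigma.symm (nabla' (sigma m)))
        = (2 * uVar k)⁻¹ • D m) := by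
  refine ⟨fun c m ↦ sigma.injective ?_, fun m ↦ sigma.injective ?_⟩
  · simp only [map_neg, map_add, hsemi, AddEquiv.apply_symm_apply, hL', hδe,
      neg_smul, smul_neg]
    abel
  · have hu : e (2 * uVar k)⁻¹ = -(2 * uVar k)⁻¹ := by
      rw [map_inv₀, map_mul, map_ofNat, he, mul_neg, inv_neg]
    rw [map_sub, hsemi, map_neg, map_neg, map_neg, hsigmaD, hsigmaD,
      AddEquiv.apply_symm_apply, AddEquiv.apply_symm_apply, hu, neg_smul, ← hC']
    abel
end
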